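/- Uniform positive lower bound for the spatial derivative of the convolved profile: define Λ(t,z) := ∫₀^∞ p(t, z−y) U_{**}(y) dy. Then for all t > 0 and z ≥ 0 one has ∂_z Λ(t,z) > 0, and moreover for every T < ∞ and L < ∞ there exists c₁ = c₁(T,L) > 0 such that ∂_z Λ(t,z) ≥ c₁ for all 0 ≤ z ≤ L and 0 < t ≤ T. -/

import Mathlib

open MeasureTheory Real Set

/-- The heat kernel `p(t,x) = (2πt)^{-1/2} exp(-x²/(2t))`. -/
noncomputable def heatK (t x : ℝ) : ℝ :=
  (Real.sqrt (2 * Real.pi * t))⁻¹ * Real.exp (-x ^ 2 / (2 * t))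

/-- The Gaussian tail `Φ̃(t,x) = ∫ₓ^∞ p(t,y) dy`. -/
noncomputable def gaussTail (t x : ℝ) : ℝ := ∫ y in Set.Ioi x, heatK t y

/-- The density `u₁(t,x) = -2∂ₓp(t,x) + 4Φ̃(t,x) = (2x/t)p(t,x) + 4Φ̃(t,x)`. -/
noncomputable def u1 (t x : ℝ) : ℝ := (2 * x / t) * heatK t x + 4 * gaussTail t x

/-- The profile `U_{**}(y) = ∫₀^y u₁(1/2, w) dw`. -/
noncomputable def Ustst (y : ℝ) : ℝ := ∫ w in (0:ℝ)..y, u1 (1 / 2) w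

/-- The convolved profile `Λ(t,z) = ∫₀^∞ p(t, z-y) U_{**}(y) dy`. -/
noncomputable def Lam (t z : ℝ) : ℝ := ∫ y in Set.Ioi (0:ℝ), heatK t (z - y) * Ustst y

open Filter Topology

lemma heatK_eq (t x : ℝ) :
    heatK t x = (√(2 * π * t))⁻¹ * exp (-(1 / (2 * t)) * x ^ 2) := by
  unfold heatK
  congr 2
  ring

lemma heatK_pos {t : ℝ} (ht : 0 < t) (x : ℝ) : 0 < heatK t x := by
  unfold heatK
  positivity

lemma continuous_heatK (t : ℝ) : Continuous (heatK t) := by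
  unfold heatK
  fun_prop

lemma integrable_heatK {t : ℝ} (ht : 0 < t) : Integrable (heatK t) := by
  simp_rw [funext (heatK_eq t)]
  exact (integrable_exp_neg_mul_sq (by positivity)).const_mul _

lemma integrable_heatK_mul_self {t : ℝ} (ht : 0 < t) : Integrable (fun x ↦ heatK t x * x) := by
  have h := (integrable_mul_exp_neg_mul_sq (b := 1 / (2 * t)) (by positivity)).const_mul
    (√(2 * π * t))⁻¹
  refine h.congr (Eventually.of_forall fun x ↦ ?_)
  simp only [heatK_eq]
  ring

lemma gaussTail_pos {t : ℝ} (ht : 0 < t) (x : ℝ) : 0 < gaussTail t x := by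
  unfold gaussTail
  rw [setIntegral_pos_iff_support_of_nonneg_ae
    (Eventually.of_forall fun y ↦ (heatK_pos ht y).le) (integrable_heatK ht).integrableOn]
  have : Function.support (heatK t) = univ :=
    eq_univ_of_forall fun y ↦ (heatK_pos ht y).ne'
  simp [this]

lemma gaussTail_antitone {t : ℝ} (ht : 0 < t) : Antitone (gaussTail t) := fun _ _ hab ↦
  setIntegral_mono_set (integrable_heatK ht).integrableOn
    (Eventually.of_forall fun y ↦ (heatK_pos ht y).le) (Ioi_subset_Ioi hab).eventuallyLE

lemma gaussTail_le {t : ℝ} (ht : 0 < t) (x : ℝ) : gaussTail t x ≤ ∫ y, heatK t y :=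
  setIntegral_le_integral (integrable_heatK ht)
    (Eventually.of_forall fun y ↦ (heatK_pos ht y).le)

lemma continuous_gaussTail {t : ℝ} (ht : 0 < t) : Continuous (gaussTail t) := by
  have h : gaussTail t = fun x ↦ gaussTail t 0 - ∫ y in (0 : ℝ)..x, heatK t y := by
    ext x
    have := intervalIntegral.integral_Ioi_sub_Ioi' (a := 0) (b := x)
      (integrable_heatK ht).integrableOn (integrable_heatK ht).integrableOn
    unfold gaussTail
    linarith
  rw [h]
  exact continuous_const.sub
    (intervalIntegral.continuous_primitive (fun _ _ ↦ (integrable_heatK ht).intervalIntegrable) 0)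

lemma continuous_u1 {t : ℝ} (ht : 0 < t) : Continuous (u1 t) := by
  have := continuous_heatK t
  have := continuous_gaussTail ht
  unfold u1
  fun_prop

lemma four_mul_gaussTail_le_u1 {t x : ℝ} (ht : 0 < t) (hx : 0 ≤ x) :
    4 * gaussTail t x ≤ u1 t x := by
  have := (heatK_pos ht x).le
  have : 0 ≤ 2 * x / t * heatK t x := by positivity
  unfold u1
  linarith

lemma u1_pos {t x : ℝ} (ht : 0 < t) (hx : 0 ≤ x) : 0 < u1 t x :=
  (mul_pos four_pos (gaussTail_pos ht x)).trans_le (four_mul_gaussTail_le_u1 ht hx)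

lemma exists_abs_u1_half_le : ∃ C : NNReal, ∀ x, |u1 (1 / 2) x| ≤ C := by
  have hG : 0 ≤ ∫ y, heatK (1 / 2) y :=
    integral_nonneg fun y ↦ (heatK_pos (by norm_num) y).le
  refine ⟨⟨4 + 4 * ∫ y, heatK (1 / 2) y, by positivity⟩, fun x ↦ ?_⟩
  have hx : |x| * exp (-x ^ 2) ≤ 1 := by
    rw [exp_neg, ← div_eq_mul_inv, div_le_one (exp_pos _), ← sq_abs]
    nlinarith [add_one_le_exp (|x| ^ 2), sq_nonneg (|x| - 1)]
  have hπ : (√π)⁻¹ ≤ 1 :=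
    inv_le_one_of_one_le₀ (one_le_sqrt.2 (by linarith [pi_gt_three]))
  have hK : heatK (1 / 2) x = (√π)⁻¹ * exp (-x ^ 2) := by
    rw [heatK, show 2 * π * (1 / 2) = π by ring, show (2 : ℝ) * (1 / 2) = 1 by norm_num, div_one]
  have h1 : |2 * x / (1 / 2) * heatK (1 / 2) x| ≤ 4 := by
    rw [hK, abs_mul, abs_mul, abs_of_pos (exp_pos _), abs_of_nonneg (a := (√π)⁻¹) (by positivity),
      show 2 * x / (1 / 2) = 4 * x by ring, abs_mul, abs_of_pos (four_pos (α := ℝ))]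
    have := mul_le_mul hx hπ (by positivity) zero_le_one
    linarith
  have h2 : |4 * gaussTail (1 / 2) x| ≤ 4 * ∫ y, heatK (1 / 2) y := by
    rw [abs_of_pos (mul_pos four_pos (gaussTail_pos (by norm_num) x))]
    linarith [gaussTail_le (t := 1 / 2) (by norm_num) x]
  exact (abs_add_le _ _).trans (add_le_add h1 h2)

lemma hasDerivAt_Ustst (x : ℝ) : HasDerivAt Ustst (u1 (1 / 2) x) x :=
  have h := continuous_u1 (t := 1 / 2) (by norm_num)
  intervalIntegral.integral_hasDerivAt_right (h.intervalIntegrable _ _)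
    (h.stronglyMeasurableAtFilter _ _) h.continuousAt

/-- The extension of `Ustst` from the half-line by zero. -/
noncomputable def UststExt (x : ℝ) : ℝ := Ustst (max x 0)

lemma UststExt_of_nonpos {x : ℝ} (hx : x ≤ 0) : UststExt x = 0 := by
  simp [UststExt, max_eq_right hx, Ustst]

lemma UststExt_of_nonneg {x : ℝ} (hx : 0 ≤ x) : UststExt x = Ustst x := by
  simp [UststExt, max_eq_left hx]

lemma hasDerivAt_UststExt {x : ℝ} (hx : x ≠ 0) :
    HasDerivAt UststExt ((Ioi 0).indicator (u1 (1 / 2)) x) x := by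
  rcases hx.lt_or_gt with h | h
  · rw [indicator_of_notMem (by simpa using h.le)]
    refine (hasDerivAt_const x (0 : ℝ)).congr_of_eventuallyEq ?_
    filter_upwards [Iio_mem_nhds h] with y hy using UststExt_of_nonpos (le_of_lt hy)
  · rw [indicator_of_mem (by simpa using h)]
    refine (hasDerivAt_Ustst x).congr_of_eventuallyEq ?_
    filter_upwards [Ioi_mem_nhds h] with y hy using UststExt_of_nonneg (le_of_lt hy)

lemma lipschitzWith_UststExt {C : NNReal} (hC : ∀ x, |u1 (1 / 2) x| ≤ C) :
    LipschitzWith C UststExt := by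
  have h : LipschitzWith C Ustst := by
    refine lipschitzWith_of_nnnorm_deriv_le (fun x ↦ (hasDerivAt_Ustst x).differentiableAt) ?_
    intro x
    rw [(hasDerivAt_Ustst x).deriv]
    exact hC x
  have := h.comp (LipschitzWith.id.max_const (0 : ℝ))
  rwa [mul_one] at this

lemma Lam_eq_integral (t z : ℝ) : Lam t z = ∫ s, heatK t s * UststExt (z - s) := by
  rw [← integral_sub_left_eq_self (fun s ↦ heatK t s * UststExt (z - s)) volume z]
  simp only [sub_sub_cancel]
  rw [← setIntegral_eq_integral_of_forall_compl_eq_zero (s := Ioi (0 : ℝ))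
    fun y hy ↦ by rw [UststExt_of_nonpos (by simpa using hy), mul_zero]]
  exact setIntegral_congr_fun measurableSet_Ioi fun y hy ↦ by
    simp only [UststExt_of_nonneg (le_of_lt hy)]

lemma hasDerivAt_Lam {t : ℝ} (ht : 0 < t) (z : ℝ) :
    Integrable (fun s ↦ heatK t s * (Ioi 0).indicator (u1 (1 / 2)) (z - s)) ∧
    HasDerivAt (fun w ↦ Lam t w)
      (∫ s, heatK t s * (Ioi 0).indicator (u1 (1 / 2)) (z - s)) z := by
  obtain ⟨C, hC⟩ := exists_abs_u1_half_le
  have hL := lipschitzWith_UststExt hC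
  have hKc := continuous_heatK t
  have hcont (w : ℝ) : Continuous fun s ↦ heatK t s * UststExt (w - s) :=
    hKc.mul (hL.continuous.comp (continuous_const.sub continuous_id))
  simp_rw [Lam_eq_integral]
  refine hasDerivAt_integral_of_dominated_loc_of_lip (s := univ) (bound := fun s ↦ heatK t s * C)
    univ_mem (Eventually.of_forall fun w ↦ (hcont w).aestronglyMeasurable) ?_ ?_
    (Eventually.of_forall fun s ↦ ?_) ((integrable_heatK ht).mul_const _) ?_
  · refine (((integrable_heatK ht).mul_const (C * |z|)).add
      ((integrable_heatK_mul_self ht).norm.const_mul C)).mono' (hcont z).aestronglyMeasurable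
      (Eventually.of_forall fun s ↦ ?_)
    have h : |UststExt (z - s)| ≤ C * |z - s| := by
      simpa [UststExt_of_nonpos le_rfl, Real.dist_eq] using hL.dist_le_mul (z - s) 0
    have hK := heatK_pos ht s
    simp only [norm_eq_abs, abs_mul, abs_of_pos hK, Pi.add_apply]
    calc heatK t s * |UststExt (z - s)| ≤ heatK t s * (C * (|z| + |s|)) := by
          gcongr
          exact h.trans (mul_le_mul_of_nonneg_left (abs_sub z s) C.2)
      _ = heatK t s * (C * |z|) + C * (heatK t s * |s|) := by ring
  · refine (hKc.measurable.mul ?_).aestronglyMeasurable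
    exact ((continuous_u1 (by norm_num)).measurable.indicator measurableSet_Ioi).comp
      (measurable_const.sub measurable_id)
  · refine LipschitzWith.lipschitzOnWith (LipschitzWith.of_dist_le_mul fun x y ↦ ?_)
    have hK := heatK_pos ht s
    have h := hL.dist_le_mul (x - s) (y - s)
    rw [dist_sub_right] at h
    rw [Real.dist_eq, ← mul_sub, abs_mul, abs_of_pos hK, ← Real.dist_eq, coe_nnabs,
      abs_of_nonneg (by positivity), mul_assoc]
    gcongr
  · filter_upwards [Measure.ae_ne volume z] with s hs
    exact ((hasDerivAt_UststExt (sub_ne_zero.2 hs.symm)).comp_sub_const z s).const_mul _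

lemma le_deriv_Lam {t z M : ℝ} (ht : 0 < t) (hz : 0 ≤ z) (hM : z + √t ≤ M) :
    (√(2 * π))⁻¹ * exp (-1 / 2) * (4 * gaussTail (1 / 2) M) ≤ deriv (fun w ↦ Lam t w) z := by
  obtain ⟨hint, hderiv⟩ := hasDerivAt_Lam ht z
  rw [hderiv.deriv]
  have hG := gaussTail_pos (t := 1 / 2) (by norm_num) M
  have hnonneg (s : ℝ) : 0 ≤ heatK t s * (Ioi 0).indicator (u1 (1 / 2)) (z - s) :=
    mul_nonneg (heatK_pos ht s).le
      (indicator_nonneg (fun x hx ↦ (u1_pos (by norm_num) (le_of_lt hx)).le) _)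
  refine le_trans ?_ (setIntegral_le_integral (s := Ioo (-√t) 0) hint
    (Eventually.of_forall hnonneg))
  have hst : √t * √t = t := mul_self_sqrt ht.le
  have hpos : 0 < √t := sqrt_pos.2 ht
  have hbound : ∀ s ∈ Ioo (-√t) 0, (√(2 * π * t))⁻¹ * exp (-1 / 2) * (4 * gaussTail (1 / 2) M) ≤
      heatK t s * (Ioi 0).indicator (u1 (1 / 2)) (z - s) := by
    rintro s ⟨hs1, hs2⟩
    have hzs : 0 < z - s := by linarith
    rw [indicator_of_mem (by simpa using hzs)]
    refine mul_le_mul ?_ ?_ (by positivity) (heatK_pos ht s).le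
    · unfold heatK
      refine mul_le_mul_of_nonneg_left (exp_le_exp.2 ?_) (by positivity)
      rw [div_le_div_iff₀ (by norm_num) (by positivity)]
      nlinarith
    · refine le_trans ?_ (four_mul_gaussTail_le_u1 (by norm_num) hzs.le)
      gcongr
      exact gaussTail_antitone (by norm_num) (by linarith)
  refine le_trans (le_of_eq ?_)
    (setIntegral_ge_of_const_le_real measurableSet_Ioo (by simp) hbound hint.integrableOn)
  rw [volume_real_Ioo_of_le (by linarith), sqrt_mul (x := 2 * π) (by positivity) t]
  field_simp
  ring

/-- `∂_z Λ(t,z) > 0` for all `t > 0`, `z ≥ 0`, and on every compact rectangle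
`(0,T] × [0,L]` there is a uniform positive lower bound `c₁ = c₁(T,L) > 0`. -/
theorem convolved_profile_deriv_pos :
    (∀ t > (0:ℝ), ∀ z : ℝ, 0 ≤ z → 0 < deriv (fun w : ℝ => Lam t w) z) ∧
    (∀ T L : ℝ, ∃ c₁ : ℝ, 0 < c₁ ∧
      ∀ t z : ℝ, 0 < t → t ≤ T → 0 ≤ z → z ≤ L → c₁ ≤ deriv (fun w : ℝ => Lam t w) z) := by
  have hpos (M : ℝ) : 0 < (√(2 * π))⁻¹ * exp (-1 / 2) * (4 * gaussTail (1 / 2) M) := by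
    have := gaussTail_pos (t := 1 / 2) (by norm_num) M
    positivity
  refine ⟨fun t ht z hz ↦ (hpos _).trans_le (le_deriv_Lam ht hz le_rfl),
    fun T L ↦ ⟨_, hpos (L + √T), fun t z ht htT hz hzL ↦ le_deriv_Lam ht hz ?_⟩⟩
  gcongr
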